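/- Let μ ≥ 0, L > 0, and let f : V → ℝ be differentiable, μ-convex, with L-Lipschitz gradient and global minimizer x*. Let γ₀ > 0, x₀, v₀ ∈ V, and generate sequences by: α_k = √(γ_k/L), β_k = 1/(Lα_k), (x_{k+1} - x_k)/α_k = v_k - x_{k+1} - β_k∇f(x_k), (v_{k+1} - v_k)/α_k = (μ/γ_k)(x_{k+1} - v_{k+1}) - (1/γ_k)∇f(x_{k+1}), (γ_{k+1} - γ_k)/α_k = μ - γ_{k+1}. Define λ₀ = 1, λ_k = ∏_{i=0}^{k-1} 1/(1+α_i) and L_k = f(x_k) - f(x*) + (γ_k/2)‖v_k - x*‖². Then for every k ≥ 0, L_k + (1/(2L))·∑_{i=0}^{k-1} (λ_k/λ_i)‖∇f(x_i)‖² ≤ λ_k·L₀. -/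

import Mathlib

open scoped RealInnerProductSpace


lemma hnag_descent {V : Type*} [NormedAddCommGroup V] [InnerProductSpace ℝ V] [CompleteSpace V]
    (L : ℝ) (f : V → ℝ) (f' : V → V)
    (hdiff : ∀ z, HasGradientAt f (f' z) z)
    (hlip : ∀ z w : V, ‖f' z - f' w‖ ≤ L * ‖z - w‖) (x d : V) :
    f (x + d) ≤ f x + ⟪f' x, d⟫ + L / 2 * ‖d‖ ^ 2 := by
  have hder : ∀ t : ℝ, HasDerivAt
      (fun t : ℝ => f (x + t • d) - t * ⟪f' x, d⟫ - L / 2 * ‖d‖ ^ 2 * t ^ 2)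
      (⟪f' (x + t • d), d⟫ - ⟪f' x, d⟫ - L * ‖d‖ ^ 2 * t) t := by
    intro t
    have ha : HasDerivAt (fun t : ℝ => x + t • d) d t := by
      simpa using ((hasDerivAt_id t).smul_const d).const_add x
    have hb := (hdiff (x + t • d)).hasFDerivAt.comp_hasDerivAt t ha
    have hc : HasDerivAt (fun t : ℝ => f (x + t • d)) ⟪f' (x + t • d), d⟫ t := by
      simpa [Function.comp_def] using hb
    have h4 := (hc.sub ((hasDerivAt_id t).mul_const ⟪f' x, d⟫)).sub
      ((hasDerivAt_pow 2 t).const_mul (L / 2 * ‖d‖ ^ 2))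
    refine h4.congr_deriv ?_
    norm_num
    ring
  have hanti : AntitoneOn
      (fun t : ℝ => f (x + t • d) - t * ⟪f' x, d⟫ - L / 2 * ‖d‖ ^ 2 * t ^ 2) (Set.Icc 0 1) := by
    apply antitoneOn_of_deriv_nonpos (convex_Icc 0 1)
    · exact fun t _ => (hder t).continuousAt.continuousWithinAt
    · exact fun t _ => (hder t).differentiableAt.differentiableWithinAt
    · intro t ht
      rw [interior_Icc] at ht
      rw [(hder t).deriv, ← inner_sub_left]
      have h5 := real_inner_le_norm (f' (x + t • d) - f' x) d
      have h6 := hlip (x + t • d) x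
      rw [add_sub_cancel_left, norm_smul, Real.norm_of_nonneg ht.1.le] at h6
      have h7 := mul_le_mul_of_nonneg_right h6 (norm_nonneg d)
      nlinarith
  have h := hanti (Set.left_mem_Icc.2 zero_le_one) (Set.right_mem_Icc.2 zero_le_one) zero_le_one
  simp at h
  linarith

lemma hnag_coco {V : Type*} [NormedAddCommGroup V] [InnerProductSpace ℝ V] [CompleteSpace V]
    (L : ℝ) (hL : 0 < L) (f : V → ℝ) (f' : V → V)
    (hdiff : ∀ z, HasGradientAt f (f' z) z)
    (hconv : ∀ z w : V, 0 ≤ f z - f w - ⟪f' w, z - w⟫)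
    (hlip : ∀ z w : V, ‖f' z - f' w‖ ≤ L * ‖z - w‖) (x y : V) :
    f y + ⟪f' y, x - y⟫ + 1 / (2 * L) * ‖f' x - f' y‖ ^ 2 ≤ f x := by
  have hd := hnag_descent L f f' hdiff hlip x (-(L⁻¹ • (f' x - f' y)))
  have hc := hconv (x + -(L⁻¹ • (f' x - f' y))) y
  have e : x + -(L⁻¹ • (f' x - f' y)) - y = (x - y) - L⁻¹ • (f' x - f' y) := by abel
  rw [e, inner_sub_right, inner_smul_right] at hc
  rw [inner_neg_right, inner_smul_right, norm_neg, norm_smul, mul_pow,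
    Real.norm_of_nonneg (inv_nonneg.2 hL.le)] at hd
  have h8 : ⟪f' x, f' x - f' y⟫ - ⟪f' y, f' x - f' y⟫ = ‖f' x - f' y‖ ^ 2 := by
    rw [← inner_sub_left, real_inner_self_eq_norm_sq]
  have h9 : L / 2 * (L⁻¹ ^ 2 * ‖f' x - f' y‖ ^ 2) = L⁻¹ / 2 * ‖f' x - f' y‖ ^ 2 := by
    field_simp
  have h10 : 1 / (2 * L) = L⁻¹ / 2 := by field_simp
  have h11 : L⁻¹ * ⟪f' x, f' x - f' y⟫ - L⁻¹ * ⟪f' y, f' x - f' y⟫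
      = L⁻¹ * ‖f' x - f' y‖ ^ 2 := by rw [← h8]; ring
  rw [h10]
  linarith

/-- One step of the scheme, with the update rules written without division. -/
lemma hnag_step {V : Type*} [NormedAddCommGroup V] [InnerProductSpace ℝ V]
    (μ L γ γ' α F F' Fs : ℝ) (hL : 0 < L) (hγ : 0 < γ) (hα : α ^ 2 * L = γ) (hα0 : 0 < α)
    (hμ : 0 ≤ μ) (x x' v v' s g g' : V)
    (h1 : x' - x = α • (v - x') - L⁻¹ • g)
    (h2 : γ • (v' - v) = (α * μ) • (x' - v') - α • g')
    (h3 : γ' * (1 + α) = γ + α * μ)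
    (hc : μ / 2 * ‖s - x'‖ ^ 2 ≤ Fs - F' - ⟪g', s - x'⟫)
    (hco : F' + ⟪g', x - x'⟫ + 1 / (2 * L) * ‖g - g'‖ ^ 2 ≤ F) :
    (1 + α) * (F' - Fs + γ' / 2 * ‖v' - s‖ ^ 2) + 1 / (2 * L) * ‖g‖ ^ 2
      ≤ F - Fs + γ / 2 * ‖v - s‖ ^ 2 := by
  have a1 : ‖v - s‖ ^ 2 = ‖v' - s‖ ^ 2 - 2 * ⟪v' - v, v' - s⟫ + ‖v' - v‖ ^ 2 := by
    rw [show v - s = (v' - s) - (v' - v) by abel, norm_sub_sq_real, real_inner_comm]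
  have a2 : ‖s - x'‖ ^ 2 = ‖x' - v'‖ ^ 2 + 2 * ⟪x' - v', v' - s⟫ + ‖v' - s‖ ^ 2 := by
    rw [norm_sub_rev, show x' - s = (x' - v') + (v' - s) by abel, norm_add_sq_real]
  have a3 : γ * ⟪v' - v, v' - s⟫ = α * μ * ⟪x' - v', v' - s⟫ - α * ⟪g', v' - s⟫ := by
    rw [← real_inner_smul_left, h2, inner_sub_left, real_inner_smul_left, real_inner_smul_left]
  have a4 : ⟪g', s - x'⟫ = ⟪g', v' - v⟫ + ⟪g', v - x'⟫ - ⟪g', v' - s⟫ := by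
    rw [← inner_add_right, ← inner_sub_right]; congr 1; abel
  have a5 : ⟪g', x - x'⟫ = L⁻¹ * ⟪g, g'⟫ - α * ⟪g', v - x'⟫ := by
    rw [show x - x' = L⁻¹ • g - α • (v - x') by rw [← neg_sub x' x, h1]; abel,
      inner_sub_right, inner_smul_right, inner_smul_right, real_inner_comm]
  have a6 := norm_sub_sq_real g g'
  have a7 : 0 ≤ ‖γ • (v' - v) + α • g'‖ ^ 2 := sq_nonneg _
  rw [norm_add_sq_real, norm_smul, norm_smul, real_inner_smul_left, inner_smul_right, mul_pow,
    mul_pow, Real.norm_of_nonneg hγ.le, Real.norm_of_nonneg hα0.le,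
    real_inner_comm] at a7
  have a8 : 0 ≤ γ / 2 * ‖v' - v‖ ^ 2 + α * ⟪g', v' - v⟫ + L⁻¹ / 2 * ‖g'‖ ^ 2 := by
    have : γ / 2 * ‖v' - v‖ ^ 2 + α * ⟪g', v' - v⟫ + L⁻¹ / 2 * ‖g'‖ ^ 2
      = (γ ^ 2 * ‖v' - v‖ ^ 2 + 2 * (γ * (α * ⟪g', v' - v⟫)) + α ^ 2 * ‖g'‖ ^ 2) / (2 * γ) := by
      have : L⁻¹ = α ^ 2 / γ := by rw [← hα]; field_simp
      rw [this]; field_simp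
    rw [this]; positivity
  have h10 : 1 / (2 * L) = L⁻¹ / 2 := by field_simp
  have a9 : 0 ≤ α * μ * ‖x' - v'‖ ^ 2 := by positivity
  have hc' := mul_le_mul_of_nonneg_left hc hα0.le
  have b : (1 + α) * (γ' / 2 * ‖v' - s‖ ^ 2) = (γ + α * μ) / 2 * ‖v' - s‖ ^ 2 := by
    rw [← h3]; ring
  rw [h10] at hco ⊢
  rw [mul_add, b, a1]
  rw [a2, a4] at hc'
  rw [a5, a6] at hco
  linarith

/-- Convergence of the explicit HNAG scheme (Algorithm 1):
`L_k + (1/(2L))∑_{i<k} (λ_k/λ_i)‖∇f(x_i)‖² ≤ λ_k L₀`. -/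
theorem explicit_hnag_convergence
    {V : Type*} [NormedAddCommGroup V] [InnerProductSpace ℝ V] [CompleteSpace V]
    (μ L : ℝ) (hμ : 0 ≤ μ) (hL : 0 < L) (f : V → ℝ) (f' : V → V)
    (hdiff : ∀ z, HasGradientAt f (f' z) z)
    (hconv : ∀ z w : V, f z - f w - ⟪f' w, z - w⟫ ≥ μ / 2 * ‖z - w‖ ^ 2)
    (hlip : ∀ z w : V, ‖f' z - f' w‖ ≤ L * ‖z - w‖)
    (xstar : V) (hmin : ∀ z, f xstar ≤ f z)
    (x v : ℕ → V) (γ α β lam : ℕ → ℝ) (hγ0 : 0 < γ 0)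
    (hαdef : ∀ k, α k = Real.sqrt (γ k / L)) (hβ : ∀ k, β k = 1 / (L * α k))
    (h1 : ∀ k, (α k)⁻¹ • (x (k + 1) - x k) = v k - x (k + 1) - β k • f' (x k))
    (h2 : ∀ k, (α k)⁻¹ • (v (k + 1) - v k)
        = (μ / γ k) • (x (k + 1) - v (k + 1)) - (1 / γ k) • f' (x (k + 1)))
    (h3 : ∀ k, (γ (k + 1) - γ k) / α k = μ - γ (k + 1))
    (hlam : ∀ k, lam k = ∏ i ∈ Finset.range k, (1 + α i)⁻¹)
    (k : ℕ) :
    (f (x k) - f xstar + γ k / 2 * ‖v k - xstar‖ ^ 2)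
        + 1 / (2 * L) * ∑ i ∈ Finset.range k, (lam k / lam i) * ‖f' (x i)‖ ^ 2
      ≤ lam k * (f (x 0) - f xstar + γ 0 / 2 * ‖v 0 - xstar‖ ^ 2) := by
  have hγ : ∀ k, 0 < γ k := by
    intro k
    induction k with
    | zero => exact hγ0
    | succ n ih =>
      have ha : 0 < α n := by rw [hαdef]; exact Real.sqrt_pos.2 (div_pos ih hL)
      have h := h3 n
      rw [div_eq_iff ha.ne'] at h
      have h' : γ (n + 1) * (1 + α n) = γ n + α n * μ := by linarith
      have : 0 < γ (n + 1) * (1 + α n) := by rw [h']; positivity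
      exact pos_of_mul_pos_left this (by linarith)
  have hα : ∀ k, 0 < α k := by
    intro k; rw [hαdef]; exact Real.sqrt_pos.2 (div_pos (hγ k) hL)
  have hstep : ∀ k, (1 + α k) * (f (x (k + 1)) - f xstar + γ (k + 1) / 2 * ‖v (k + 1) - xstar‖ ^ 2)
      + 1 / (2 * L) * ‖f' (x k)‖ ^ 2 ≤ f (x k) - f xstar + γ k / 2 * ‖v k - xstar‖ ^ 2 := by
    intro k
    have ha := hα k
    have hg := hγ k
    refine hnag_step μ L (γ k) (γ (k + 1)) (α k) _ _ _ hL hg ?_ ha hμ (x k) (x (k + 1)) _ _ _ _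
      (f' (x (k + 1))) ?_ ?_ ?_ (hconv _ _) (hnag_coco L hL f f' hdiff ?_ hlip _ _)
    · rw [hαdef, Real.sq_sqrt (div_pos hg hL).le]; field_simp
    · have h := congrArg (fun z => α k • z) (h1 k)
      simp only [smul_inv_smul₀ ha.ne'] at h
      rw [h, smul_sub, smul_smul, hβ]
      congr 2
      field_simp
    · have h := congrArg (fun z => (γ k * α k) • z) (h2 k)
      simp only [smul_sub _ _ ((1 / γ k) • _), smul_smul] at h
      rw [show γ k * α k * (α k)⁻¹ = γ k by field_simp,
        show γ k * α k * (μ / γ k) = α k * μ by field_simp,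
        show γ k * α k * (1 / γ k) = α k by field_simp] at h
      exact h
    · have h := h3 k
      rw [div_eq_iff ha.ne'] at h
      linarith
    · intro z w
      have := hconv z w
      have : 0 ≤ μ / 2 * ‖z - w‖ ^ 2 := by positivity
      linarith
  induction k with
  | zero => simp [hlam]
  | succ n ih =>
    have ha := hα n
    have hl : lam (n + 1) = lam n * (1 + α n)⁻¹ := by
      rw [hlam, hlam, Finset.prod_range_succ]
    have hpos : 0 < lam n := by
      rw [hlam]; exact Finset.prod_pos fun i _ => inv_pos.2 (by linarith [hα i])
    have hs : ∑ i ∈ Finset.range (n + 1), (lam (n + 1) / lam i) * ‖f' (x i)‖ ^ 2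
        = (1 + α n)⁻¹ * (∑ i ∈ Finset.range n, (lam n / lam i) * ‖f' (x i)‖ ^ 2
          + ‖f' (x n)‖ ^ 2) := by
      rw [Finset.sum_range_succ, mul_add, Finset.mul_sum, hl]
      congr 1
      · refine Finset.sum_congr rfl fun i _ => ?_
        ring
      · field_simp
    rw [hs, hl]
    have hp : 0 < 1 + α n := by linarith
    have hst := hstep n
    refine le_of_mul_le_mul_left ?_ hp
    generalize f (x (n + 1)) - f xstar + γ (n + 1) / 2 * ‖v (n + 1) - xstar‖ ^ 2 = A at *
    generalize f (x 0) - f xstar + γ 0 / 2 * ‖v 0 - xstar‖ ^ 2 = B at *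
    generalize ∑ i ∈ Finset.range n, (lam n / lam i) * ‖f' (x i)‖ ^ 2 = S at *
    have e1 : (1 + α n) * (A + 1 / (2 * L) * ((1 + α n)⁻¹ * (S + ‖f' (x n)‖ ^ 2)))
        = (1 + α n) * A + 1 / (2 * L) * ‖f' (x n)‖ ^ 2 + 1 / (2 * L) * S := by
      field_simp
      ring
    have e2 : (1 + α n) * (lam n * (1 + α n)⁻¹ * B) = lam n * B := by
      field_simp
    rw [e1, e2]
    linarith
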